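/- arXiv:1507.01703 — 2 statements merged into one kernel-verified Lean document; each statement's English description precedes it below -/
import Mathlib

section
/- The infinite sum of 2^i/(i^2 · binom(2i, i)) for i from 1 to infinity equals π²/8. -/
open Real Finset

noncomputable def auxJ (N : ℕ) : ℝ := ∫ x in (0:ℝ)..(π/4), (π/4 - x) * sin x ^ (2*N)

lemma sin_sq_pi4 : sin (π/4) ^ 2 = 1/2 := by
  rw [Real.sin_pi_div_four, div_pow, Real.sq_sqrt (by norm_num)]; norm_num

lemma auxJ_rec (N : ℕ) :
    (2*N+1) * auxJ N - (2*N+2) * auxJ (N+1) = (1/2)^(N+1) / (2*N+2) := by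
  have hd : ∀ x ∈ Set.uIcc (0:ℝ) (π/4), HasDerivAt
      (fun x : ℝ => (π/4 - x) * (cos x * sin x ^ (2*N+1)) + sin x ^ (2*N+2) / (2*N+2))
      ((2*N+1) * ((π/4 - x) * sin x ^ (2*N)) - (2*N+2) * ((π/4 - x) * sin x ^ (2*(N+1)))) x := by
    intro x _
    have h1 := ((hasDerivAt_id x).const_sub (π/4)).mul
      ((hasDerivAt_cos x).mul ((hasDerivAt_sin x).pow (2*N+1)))
    have h2 := ((hasDerivAt_sin x).pow (2*N+2)).div_const (2*(N:ℝ)+2)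
    refine (h1.add h2).congr_deriv ?_
    have hc : cos x ^ 2 = 1 - sin x ^ 2 := by rw [← sin_sq_add_cos_sq x]; ring
    have hN : (2*(N:ℝ)+2) ≠ 0 := by positivity
    try simp only [id, Pi.mul_apply, Pi.pow_apply]
    push_cast
    try simp only [Nat.add_sub_cancel, show 2*N+2-1 = 2*N+1 by omega]
    field_simp
    ring_nf
    rw [hc]
    ring
  have hi := intervalIntegral.integral_eq_sub_of_hasDerivAt hd
    (by apply Continuous.intervalIntegrable; fun_prop)
  rw [intervalIntegral.integral_sub
    (by apply Continuous.intervalIntegrable; fun_prop)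
    (by apply Continuous.intervalIntegrable; fun_prop),
    intervalIntegral.integral_const_mul, intervalIntegral.integral_const_mul] at hi
  unfold auxJ
  rw [hi, show 2*N+2 = 2*(N+1) by ring, pow_mul (sin (π/4)), sin_sq_pi4]
  simp

lemma auxJ_zero : auxJ 0 = π^2/32 := by
  have : auxJ 0 = ∫ x in (0:ℝ)..(π/4), (π/4 - x) := by simp [auxJ]
  rw [this, intervalIntegral.integral_sub (by simp) (by simp)]
  simp
  ring

lemma aux_bd (N : ℕ) (x : ℝ) (h0 : 0 ≤ x) (h1 : x ≤ π/4) :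
    0 ≤ (π/4 - x) * sin x ^ (2*N) ∧ (π/4 - x) * sin x ^ (2*N) ≤ (π/4) * (1/2)^N := by
  have hs : 0 ≤ sin x := sin_nonneg_of_nonneg_of_le_pi h0 (by linarith [pi_pos])
  have hs2 : sin x ≤ sin (π/4) := sin_le_sin_of_le_of_le_pi_div_two (by linarith [pi_pos])
    (by linarith [pi_pos]) h1
  have h3 : sin x ^ 2 ≤ 1/2 := by rw [← sin_sq_pi4]; gcongr
  have h4 : sin x ^ (2*N) ≤ (1/2)^N := by rw [pow_mul]; gcongr
  constructor
  · exact mul_nonneg (by linarith) (by positivity)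
  · exact mul_le_mul (by linarith) h4 (by positivity) (by positivity)

lemma auxJ_nonneg (N : ℕ) : 0 ≤ auxJ N :=
  intervalIntegral.integral_nonneg (by positivity) fun x hx => (aux_bd N x hx.1 hx.2).1

lemma auxJ_le (N : ℕ) : auxJ N ≤ (π/4)^2 * (1/2)^N := by
  have := intervalIntegral.integral_mono_on (a := 0) (b := π/4) (μ := MeasureTheory.volume)
    (f := fun x => (π/4 - x) * sin x ^ (2*N)) (g := fun _ => (π/4) * (1/2)^N) (by positivity)
    (by apply Continuous.intervalIntegrable; fun_prop)
    (by simp) fun x hx => (aux_bd N x hx.1 hx.2).2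
  refine this.trans (le_of_eq ?_)
  rw [intervalIntegral.integral_const]
  simp only [smul_eq_mul]
  ring

noncomputable def auxR (N : ℕ) : ℝ := 4 * 4^N / (N.centralBinom : ℝ) * auxJ N

lemma auxR_step (N : ℕ) : auxR N - auxR (N+1) =
    (2:ℝ)^(N+1) / (((N:ℝ)+1)^2 * ((Nat.choose (2*(N+1)) (N+1)) : ℝ)) := by
  rw [← Nat.centralBinom_eq_two_mul_choose]
  unfold auxR
  have hC : ((N:ℝ)+1) * ((N+1).centralBinom : ℝ) = 2 * (2*N+1) * (N.centralBinom : ℝ) := by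
    exact_mod_cast Nat.succ_mul_centralBinom_succ N
  have hp : (0:ℝ) < N.centralBinom := by exact_mod_cast Nat.centralBinom_pos N
  have hC' : ((N+1).centralBinom : ℝ) = 2 * (2*N+1) * (N.centralBinom : ℝ) / ((N:ℝ)+1) := by
    field_simp; linarith
  have hJ : auxJ N = ((2*N+2) * auxJ (N+1) + (1/2)^(N+1) / (2*N+2)) / (2*N+1) := by
    rw [← auxJ_rec]; field_simp; ring
  have h4 : (4:ℝ)^N = 2^N * 2^N := by rw [← mul_pow]; norm_num
  have h5 : (2:ℝ)*N+2 = 2*(N+1) := by ring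
  rw [hC', hJ, h5, pow_succ 4, h4, one_div, inv_pow, pow_succ 2]
  field_simp
  ring

lemma auxR_tendsto : Filter.Tendsto auxR Filter.atTop (nhds 0) := by
  have h := (tendsto_self_mul_const_pow_of_lt_one (r := (1/2:ℝ)) (by norm_num) (by norm_num)).const_mul
    (8 * (π/4)^2)
  rw [mul_zero] at h
  refine tendsto_of_tendsto_of_tendsto_of_le_of_le' tendsto_const_nhds h ?_ ?_
  · exact Filter.Eventually.of_forall fun N => mul_nonneg (by positivity) (auxJ_nonneg N)
  · filter_upwards [Filter.eventually_gt_atTop 0] with N hN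
    have hp : (0:ℝ) < N.centralBinom := by exact_mod_cast Nat.centralBinom_pos N
    have h4 : (4:ℝ)^N ≤ 2*N*N.centralBinom := by
      exact_mod_cast Nat.four_pow_le_two_mul_self_mul_centralBinom N hN
    have h5 : 4 * 4^N / (N.centralBinom : ℝ) ≤ 8*N := by
      rw [div_le_iff₀ hp]; linarith
    calc auxR N ≤ (8*N) * ((π/4)^2 * (1/2)^N) :=
          mul_le_mul h5 (auxJ_le N) (auxJ_nonneg N) (by positivity)
      _ = _ := by ring

theorem stmt_7 : (∑' i : ℕ, (2:ℝ)^(i+1) / (((i:ℝ)+1)^2 * ((Nat.choose (2*(i+1)) (i+1)) : ℝ))) = Real.pi^2 / 8 := by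
  apply HasSum.tsum_eq
  rw [hasSum_iff_tendsto_nat_of_nonneg (fun i => by positivity)]
  have h : ∀ n : ℕ, ∑ i ∈ range n, (2:ℝ)^(i+1) / (((i:ℝ)+1)^2 * ((Nat.choose (2*(i+1)) (i+1)) : ℝ))
      = π^2/8 - auxR n := by
    intro n
    simp_rw [← auxR_step]
    rw [Finset.sum_range_sub']
    congr 1
    simp [auxR, auxJ_zero]
    ring
  simp_rw [h]
  simpa using auxR_tendsto.const_sub (π^2/8)
end

section
/- The infinite sum over i ≥ 1 of binom(2i, i)/(16^i · (2i+1)^3) equals 7π³/216 − 1. -/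
open Real Finset

noncomputable def PP {𝕜 : Type*} [RCLike 𝕜] (c : ℕ → ℝ) (e : ℕ → ℕ) (k : ℕ) (z : 𝕜) : 𝕜 :=
  ∑' i, (c i : 𝕜) * z ^ (e i) / ((e i : ℕ) : 𝕜) ^ k

lemma PP_zero {𝕜 : Type*} [RCLike 𝕜] (c : ℕ → ℝ) (e : ℕ → ℕ) (he : ∀ i, i + 1 ≤ e i) (k : ℕ) :
    PP c e k (0 : 𝕜) = 0 := by
  unfold PP
  have : ∀ i, (c i : 𝕜) * 0 ^ (e i) / ((e i : ℕ) : 𝕜) ^ k = 0 := by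
    intro i
    have := he i
    rw [zero_pow (by omega)]; simp
  simp [this]

lemma PP_hasDerivAt {𝕜 : Type*} [RCLike 𝕜] (c : ℕ → ℝ) (hc : ∀ i, |c i| ≤ 1) (e : ℕ → ℕ)
    (he : ∀ i, i + 1 ≤ e i) (k : ℕ) (z : 𝕜) (hz : ‖z‖ < 1) :
    HasDerivAt (PP c e (k+1)) (∑' i, (c i : 𝕜) * z ^ (e i - 1) / ((e i : ℕ) : 𝕜) ^ k) z := by
  obtain ⟨r, hzr, hr1⟩ := exists_between hz
  have hr0 : 0 ≤ r := (norm_nonneg z).trans hzr.le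
  refine hasDerivAt_tsum_of_isPreconnected (u := fun i => r ^ i) (t := Metric.ball 0 r) (y₀ := 0)
    (g := fun i z => (c i : 𝕜) * z ^ (e i) / ((e i : ℕ) : 𝕜) ^ (k+1))
    (g' := fun i z => (c i : 𝕜) * z ^ (e i - 1) / ((e i : ℕ) : 𝕜) ^ k)
    (summable_geometric_of_lt_one hr0 hr1) Metric.isOpen_ball
    (convex_ball (0:𝕜) r).isPreconnected ?_ ?_ ?_ ?_ ?_
  · intro i y _
    have hp : ((e i : ℕ) : 𝕜) ≠ 0 := by
      have := he i
      exact_mod_cast (by omega : e i ≠ 0)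
    have h := (((hasDerivAt_pow (e i) y).const_mul (c i : 𝕜)).div_const (((e i : ℕ) : 𝕜) ^ (k+1)))
    refine h.congr_deriv ?_
    field_simp
    ring
  · intro i y hy
    have hy' : ‖y‖ < r := by simpa using hy
    have hei := he i
    rw [norm_div, norm_mul, norm_pow, norm_pow, RCLike.norm_ofReal, RCLike.norm_natCast]
    have h1 : (1:ℝ) ≤ (e i : ℝ) ^ k := one_le_pow₀ (by exact_mod_cast (by omega : 1 ≤ e i))
    refine (div_le_self (by positivity) h1).trans ?_
    calc |c i| * ‖y‖ ^ (e i - 1) ≤ 1 * r ^ (e i - 1) := by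
          gcongr
          exact hc i
      _ ≤ r ^ i := by
          rw [one_mul]; exact pow_le_pow_of_le_one hr0 hr1.le (by omega)
  · simpa using (norm_nonneg z).trans_lt hzr
  · have : ∀ i, (c i : 𝕜) * 0 ^ (e i) / ((e i : ℕ) : 𝕜) ^ (k+1) = 0 := by
      intro i
      have := he i
      rw [zero_pow (by omega)]; simp
    simp only [this]
    exact summable_zero
  · simpa using hzr

lemma PP_hasDerivAt' {𝕜 : Type*} [RCLike 𝕜] (c : ℕ → ℝ) (hc : ∀ i, |c i| ≤ 1) (e : ℕ → ℕ)
    (he : ∀ i, i + 1 ≤ e i) (k : ℕ) (z : 𝕜) (hz : ‖z‖ < 1) (hz0 : z ≠ 0) :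
    HasDerivAt (PP c e (k+1)) (PP c e k z / z) z := by
  convert PP_hasDerivAt c hc e he k z hz using 1
  unfold PP
  rw [← tsum_div_const]
  congr 1; ext i
  have := he i
  obtain ⟨m, hm⟩ : ∃ m, e i = m + 1 := ⟨e i - 1, by omega⟩
  rw [hm, Nat.add_sub_cancel, pow_succ]
  field_simp

lemma PP_continuousOn {𝕜 : Type*} [RCLike 𝕜] (c : ℕ → ℝ) (hc : ∀ i, |c i| ≤ 1) (e : ℕ → ℕ)
    (he : ∀ i, i + 1 ≤ e i) (k : ℕ) :
    ContinuousOn (PP c e (k+2) : 𝕜 → 𝕜) (Metric.closedBall 0 1) := by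
  unfold PP
  refine continuousOn_tsum (u := fun i : ℕ => 1 / ((i:ℝ) + 1) ^ 2) (fun i => by fun_prop) ?_ ?_
  · have := (summable_nat_add_iff 1).2 (Real.summable_one_div_nat_pow.2 (by norm_num : 1 < 2))
    simpa using this
  · intro i y hy
    have hy' : ‖y‖ ≤ 1 := by simpa using hy
    have hei : ((i:ℝ)+1) ≤ e i := by exact_mod_cast he i
    rw [norm_div, norm_mul, norm_pow, norm_pow, RCLike.norm_ofReal, RCLike.norm_natCast]
    have h1 : ((i:ℝ)+1)^2 ≤ (e i : ℝ) ^ (k+2) := by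
      calc ((i:ℝ)+1)^2 ≤ ((i:ℝ)+1)^(k+2) := pow_le_pow_right₀ (by linarith [Nat.cast_nonneg (α := ℝ) i]) (by omega)
        _ ≤ _ := by gcongr
    gcongr
    calc |c i| * ‖y‖ ^ (e i) ≤ 1 * 1 := by
          gcongr
          · exact hc i
          · exact pow_le_one₀ (norm_nonneg _) hy'
      _ = 1 := by norm_num

noncomputable def bb (i : ℕ) : ℝ := (Nat.choose (2*i) i : ℝ) / 4 ^ i

lemma bb_succ (i : ℕ) : bb (i+1) = bb i * ((2 * i + 1) / (2 * i + 2)) := by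
  have h := Nat.succ_mul_centralBinom_succ i
  have h' : ((i:ℝ) + 1) * (Nat.centralBinom (i+1) : ℝ) = 2 * (2 * i + 1) * Nat.centralBinom i := by
    exact_mod_cast h
  unfold bb
  rw [← Nat.centralBinom_eq_two_mul_choose, ← Nat.centralBinom_eq_two_mul_choose]
  have : (i:ℝ) + 1 ≠ 0 := by positivity
  rw [pow_succ]
  field_simp
  linarith

lemma bb_abs (i : ℕ) : |bb i| ≤ 1 := by
  rw [abs_of_nonneg (by unfold bb; positivity)]
  induction i with
  | zero => simp [bb]
  | succ n ih =>
    rw [bb_succ]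
    have h1 : ((2 * n + 1) / (2 * n + 2) : ℝ) ≤ 1 := by
      rw [div_le_one (by positivity)]; linarith
    have h0 : 0 ≤ bb n := by unfold bb; positivity
    have h2 : (0:ℝ) ≤ (2 * n + 1) / (2 * n + 2) := by positivity
    nlinarith

lemma bb_choose (n : ℕ) : Ring.choose (-1/2 : ℝ) n = (-1) ^ n * bb n := by
  have key : ∀ n : ℕ, (descPochhammer ℤ n).smeval (-1/2 : ℝ) = (n.factorial : ℝ) * ((-1) ^ n * bb n) := by
    intro n
    induction n with
    | zero => simp [bb]
    | succ n ih =>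
      have : (descPochhammer ℤ (n+1)).smeval (-1/2 : ℝ) = (descPochhammer ℤ n).smeval (-1/2 : ℝ) * (-1/2 - n) := by
        simp [descPochhammer_succ_right, Polynomial.smeval_mul, Polynomial.smeval_natCast]
      rw [this, ih, bb_succ, Nat.factorial_succ]
      push_cast
      have : (n:ℝ) + 1 ≠ 0 := by positivity
      field_simp
      ring
  have h := Ring.descPochhammer_eq_factorial_smul_choose (-1/2 : ℝ) n
  rw [key, nsmul_eq_mul] at h
  exact (mul_left_cancel₀ (by exact_mod_cast n.factorial_ne_zero) h).symm

lemma bb_hasSum (s : ℝ) (hs : |s| < 1) : HasSum (fun n => bb n * s ^ (2 * n)) (1 / √(1 - s^2)) := by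
  have hs2 : s ^ 2 < 1 := by rwa [sq_lt_one_iff_abs_lt_one]
  have h := (Real.one_add_rpow_hasFPowerSeriesOnBall_zero (a := -1/2)).hasSum (y := -s^2) (by
    rw [← ENNReal.ofReal_one, Metric.eball_ofReal]
    simpa [abs_of_nonneg (sq_nonneg s)] using hs)
  have hv : (1 + (0 + -s^2) : ℝ) ^ (-1/2 : ℝ) = 1 / √(1 - s^2) := by
    rw [show (1 + (0 + -s^2):ℝ) = 1 - s^2 by ring, neg_div, Real.rpow_neg (by linarith),
      Real.sqrt_eq_rpow, one_div, one_div]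
  rw [hv] at h
  have heq : ∀ n, ((binomialSeries ℝ (-1 / 2 : ℝ)) n fun _ => -s ^ 2) = bb n * s ^ (2 * n) := by
    intro n
    rw [binomialSeries_apply, bb_choose]
    simp only [List.ofFn_const, List.prod_replicate, smul_eq_mul]
    rw [neg_pow, pow_mul]
    have : ((-1:ℝ)^n) * (-1)^n = 1 := by rw [← mul_pow]; simp
    linear_combination (bb n * (s^2)^n) * this
  simp only [heq] at h
  exact h

def eo (i : ℕ) : ℕ := 2 * i + 1
def es (i : ℕ) : ℕ := i + 1
lemma heo : ∀ i, i + 1 ≤ eo i := by intro i; unfold eo; omega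
lemma hes : ∀ i, i + 1 ≤ es i := fun i => le_rfl

lemma PP_arcsin (s : ℝ) (hs : |s| < 1) : PP bb eo 1 s = arcsin s := by
  have hd : ∀ x : ℝ, |x| < 1 → HasDerivAt (fun x => PP bb eo 1 x - arcsin x) 0 x := by
    intro x hx
    have h1 := PP_hasDerivAt bb bb_abs eo heo 0 x hx
    have hx' := abs_lt.1 hx
    have h2 := Real.hasDerivAt_arcsin (x := x) (by linarith) (by linarith)
    have h3 := h1.sub h2
    refine h3.congr_deriv ?_
    have := (bb_hasSum x hx).tsum_eq
    simp only [pow_zero, div_one, eo, Nat.add_sub_cancel]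
    rw [← this]; simp
  have hd' : DifferentiableOn ℝ (fun x => PP bb eo 1 x - arcsin x) (Metric.ball 0 1) := fun x hx =>
    (hd x (by simpa using hx)).differentiableAt.differentiableWithinAt
  have := Metric.isOpen_ball.is_const_of_deriv_eq_zero (convex_ball (0:ℝ) 1).isPreconnected hd'
    (fun x hx => (hd x (by simpa using hx)).deriv) (x := s) (y := 0) (by simpa using hs) (by simp)
  simp only [PP_zero bb eo heo, Real.arcsin_zero] at this
  linarith

lemma PP_log (z : ℂ) (hz : ‖z‖ < 1) : PP (fun _ => 1) es 1 z = - Complex.log (1 - z) := by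
  rw [← (Complex.hasSum_taylorSeries_neg_log' hz).tsum_eq]
  unfold PP es
  simp

lemma PP_final : PP bb eo 3 (1/2 : ℝ) = (1/2) * (1 + ∑' i : ℕ, ((Nat.choose (2*(i+1)) (i+1)) : ℝ) / ((16:ℝ)^(i+1) * (2*((i:ℝ)+1)+1)^3)) := by
  have hsum : Summable (fun i => (Nat.choose (2*i) i : ℝ) / ((16:ℝ)^i * (2*(i:ℝ)+1)^3)) := by
    refine Summable.of_nonneg_of_le (f := fun i : ℕ => (1/4:ℝ)^i) (fun i => by positivity) ?_ (summable_geometric_of_lt_one (by norm_num) (by norm_num))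
    intro i
    have h := (abs_le.1 (bb_abs i)).2
    unfold bb at h
    have h1 : (1:ℝ) ≤ (2*(i:ℝ)+1)^3 := one_le_pow₀ (by linarith [Nat.cast_nonneg (α := ℝ) i])
    calc _ = (Nat.choose (2*i) i : ℝ) / 4 ^ i * (1/4)^i / (2*(i:ℝ)+1)^3 := by
          rw [show (16:ℝ) = 4 * 4 by norm_num, mul_pow, div_pow]; field_simp; simp
      _ ≤ (Nat.choose (2*i) i : ℝ) / 4 ^ i * (1/4)^i := div_le_self (by positivity) h1
      _ ≤ 1 * (1/4)^i := by gcongr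
      _ = _ := one_mul _
  have h0 := hsum.tsum_eq_zero_add
  have : PP bb eo 3 (1/2 : ℝ) = (1/2) * ∑' i : ℕ, (Nat.choose (2*i) i : ℝ) / ((16:ℝ)^i * (2*(i:ℝ)+1)^3) := by
    unfold PP
    rw [← tsum_mul_left]
    congr 1; ext i
    unfold bb eo
    rw [show (16:ℝ) = 4 * 4 by norm_num, mul_pow, pow_succ, pow_mul]
    norm_num
    rw [one_div, inv_pow]
    field_simp
  rw [this, h0]
  simp

lemma PP_bound {𝕜 : Type*} [RCLike 𝕜] (c : ℕ → ℝ) (hc : ∀ i, |c i| ≤ 1) (e : ℕ → ℕ)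
    (he : ∀ i, i + 1 ≤ e i) (k : ℕ) (z : 𝕜) (hz : ‖z‖ ≤ 1) (i : ℕ) :
    ‖(c i : 𝕜) * z ^ (e i) / ((e i : ℕ) : 𝕜) ^ (k+2)‖ ≤ 1 / ((i:ℝ) + 1) ^ 2 * ‖z‖ := by
  have hei : ((i:ℝ)+1) ≤ e i := by exact_mod_cast he i
  have hei' := he i
  rw [norm_div, norm_mul, norm_pow, norm_pow, RCLike.norm_ofReal, RCLike.norm_natCast]
  have h1 : ((i:ℝ)+1)^2 ≤ (e i : ℝ) ^ (k+2) := by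
    calc ((i:ℝ)+1)^2 ≤ ((i:ℝ)+1)^(k+2) :=
          pow_le_pow_right₀ (by linarith [Nat.cast_nonneg (α := ℝ) i]) (by omega)
      _ ≤ _ := by gcongr
  rw [one_div_mul_eq_div]
  gcongr
  calc |c i| * ‖z‖ ^ (e i) ≤ 1 * ‖z‖ ^ 1 := by
        gcongr ?_ * ?_
        · exact hc i
        · exact pow_le_pow_of_le_one (norm_nonneg _) hz (by omega)
    _ = ‖z‖ := by simp

lemma sum_sq : Summable (fun i : ℕ => 1 / ((i:ℝ) + 1) ^ 2) := by
  have := (summable_nat_add_iff 1).2 (Real.summable_one_div_nat_pow.2 (by norm_num : 1 < 2))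
  simpa using this

noncomputable def CC : ℝ := ∑' i : ℕ, 1 / ((i:ℝ) + 1) ^ 2

lemma CC_nonneg : 0 ≤ CC := tsum_nonneg fun i => by positivity

lemma PP_le {𝕜 : Type*} [RCLike 𝕜] (c : ℕ → ℝ) (hc : ∀ i, |c i| ≤ 1) (e : ℕ → ℕ)
    (he : ∀ i, i + 1 ≤ e i) (k : ℕ) (z : 𝕜) (hz : ‖z‖ ≤ 1) :
    ‖PP c e (k+2) z‖ ≤ CC * ‖z‖ :=
  tsum_of_norm_bounded (sum_sq.hasSum.mul_right ‖z‖) (PP_bound c hc e he k z hz)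

lemma PP_hasSum {𝕜 : Type*} [RCLike 𝕜] (c : ℕ → ℝ) (hc : ∀ i, |c i| ≤ 1) (e : ℕ → ℕ)
    (he : ∀ i, i + 1 ≤ e i) (k : ℕ) (z : 𝕜) (hz : ‖z‖ ≤ 1) :
    HasSum (fun i => (c i : 𝕜) * z ^ (e i) / ((e i : ℕ) : 𝕜) ^ (k+2)) (PP c e (k+2) z) :=
  (Summable.of_norm_bounded (sum_sq.mul_right ‖z‖) (PP_bound c hc e he k z hz)).hasSum

lemma one_abs : ∀ _ : ℕ, |(1:ℝ)| ≤ 1 := by simp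

/-- the polylogarithm -/
noncomputable def Li (k : ℕ) (z : ℂ) : ℂ := PP (fun _ => 1) es k z

lemma bern2 : (Polynomial.bernoulli 2).eval (1 / 6 : ℚ) = 1 / 36 := by
  simp_rw [Polynomial.bernoulli, Finset.sum_range_succ, Polynomial.eval_add,
    Polynomial.eval_monomial]
  rw [Finset.sum_range_zero, Polynomial.eval_zero, zero_add, _root_.bernoulli_one]
  rw [bernoulli_eq_bernoulli'_of_ne_one zero_ne_one, bernoulli'_zero,
    bernoulli_eq_bernoulli'_of_ne_one (by decide : 2 ≠ 1), bernoulli'_two]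
  norm_num

lemma bern3 : (Polynomial.bernoulli 3).eval (1 / 6 : ℚ) = 5 / 108 := by
  simp_rw [Polynomial.bernoulli, Finset.sum_range_succ, Polynomial.eval_add,
    Polynomial.eval_monomial]
  rw [Finset.sum_range_zero, Polynomial.eval_zero, zero_add, _root_.bernoulli_one]
  rw [bernoulli_eq_bernoulli'_of_ne_one zero_ne_one, bernoulli'_zero,
    bernoulli_eq_bernoulli'_of_ne_one (by decide : 2 ≠ 1), bernoulli'_two,
    bernoulli_eq_bernoulli'_of_ne_one (by decide : 3 ≠ 1), bernoulli'_three]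
  norm_num [Nat.choose]

lemma li_term (i k : ℕ) : ((1:ℝ):ℂ) * Complex.exp ((-(π/3) : ℝ) * Complex.I) ^ (es i) / ((es i : ℕ) : ℂ) ^ k
    = ((1 / ((i + 1 : ℕ):ℝ) ^ k : ℝ) : ℂ) *
      Complex.exp ((-(2 * π * ((i + 1 : ℕ):ℝ) * (1/6)) : ℝ) * Complex.I) := by
  unfold es
  rw [← Complex.exp_nat_mul]
  push_cast
  rw [one_mul, div_mul_eq_mul_div, one_mul]
  congr 2
  ring

lemma Li2_re : (Li 2 (Complex.exp ((-(π/3) : ℝ) * Complex.I))).re = π ^ 2 / 36 := by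
  have h : HasSum (fun i : ℕ => (((1:ℝ):ℂ) * Complex.exp ((-(π/3) : ℝ) * Complex.I) ^ (es i) /
      ((es i : ℕ) : ℂ) ^ 2).re) (Li 2 (Complex.exp ((-(π/3) : ℝ) * Complex.I))).re :=
    Complex.hasSum_re (PP_hasSum (fun _ => 1) one_abs es hes 0
      (Complex.exp ((-(π/3) : ℝ) * Complex.I)) (Complex.norm_exp_ofReal_mul_I _).le)
  simp only [li_term, Complex.re_ofReal_mul, Complex.exp_ofReal_mul_I_re, Real.cos_neg] at h
  have h2 := hasSum_one_div_nat_pow_mul_cos one_ne_zero (x := 1/6) (by constructor <;> norm_num)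
  rw [← hasSum_nat_add_iff' 1] at h2
  have h3 := h.unique h2
  rw [h3]
  have hb := bern2
  have hb' : (Polynomial.map (algebraMap ℚ ℝ) (Polynomial.bernoulli 2)).eval (1/6 : ℝ) =
      (((Polynomial.bernoulli 2).eval (1/6 : ℚ) : ℚ) : ℝ) := by
    rw [show (1/6 : ℝ) = algebraMap ℚ ℝ (1/6) by norm_num, Polynomial.eval_map_algebraMap,
      Polynomial.aeval_algebraMap_apply]
    simp
  simp only [mul_one, Nat.reduceAdd] at *
  rw [hb', hb]
  simp [Nat.factorial]
  ring

lemma Li3_im : (Li 3 (Complex.exp ((-(π/3) : ℝ) * Complex.I))).im = - (5 * π ^ 3 / 162) := by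
  have h : HasSum (fun i : ℕ => (((1:ℝ):ℂ) * Complex.exp ((-(π/3) : ℝ) * Complex.I) ^ (es i) /
      ((es i : ℕ) : ℂ) ^ 3).im) (Li 3 (Complex.exp ((-(π/3) : ℝ) * Complex.I))).im :=
    Complex.hasSum_im (PP_hasSum (fun _ => 1) one_abs es hes 1
      (Complex.exp ((-(π/3) : ℝ) * Complex.I)) (Complex.norm_exp_ofReal_mul_I _).le)
  simp only [li_term, Complex.im_ofReal_mul, Complex.exp_ofReal_mul_I_im, Real.sin_neg, mul_neg] at h
  have h2 := hasSum_one_div_nat_pow_mul_sin one_ne_zero (x := 1/6) (by constructor <;> norm_num)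
  rw [← hasSum_nat_add_iff' 1] at h2
  have h3 := h.unique h2.neg
  rw [h3]
  have hb := bern3
  have hb' : (Polynomial.map (algebraMap ℚ ℝ) (Polynomial.bernoulli 3)).eval (1/6 : ℝ) =
      (((Polynomial.bernoulli 3).eval (1/6 : ℚ) : ℚ) : ℝ) := by
    rw [show (1/6 : ℝ) = algebraMap ℚ ℝ (1/6) by norm_num, Polynomial.eval_map_algebraMap,
      Polynomial.aeval_algebraMap_apply]
    simp
  simp only [mul_one, Nat.reduceAdd] at *
  rw [hb', hb]
  simp [Nat.factorial]
  ring

noncomputable def Lf (θ : ℝ) : ℝ := Real.log (2 * Real.sin θ)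
noncomputable def ww (θ : ℝ) : ℂ := 2 * (Real.sin θ : ℂ) * ((Real.sin θ : ℂ) - (Real.cos θ : ℂ) * Complex.I)
noncomputable def el (θ : ℝ) : ℂ := (Lf θ : ℂ) + ((θ - π/2 : ℝ) : ℂ) * Complex.I

lemma ww_norm (θ : ℝ) (h : 0 ≤ Real.sin θ) : ‖ww θ‖ = 2 * Real.sin θ := by
  unfold ww
  have : ‖(Real.sin θ : ℂ) - (Real.cos θ : ℂ) * Complex.I‖ = 1 := by
    rw [← Complex.norm_conj, ← Complex.norm_exp_ofReal_mul_I (π/2 - θ), Complex.exp_mul_I, ← Complex.ofReal_cos, ← Complex.ofReal_sin, Real.cos_pi_div_two_sub, Real.sin_pi_div_two_sub]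
    simp only [map_sub, map_mul, Complex.conj_ofReal, Complex.conj_I, mul_neg, sub_neg_eq_add]
  rw [norm_mul, this, norm_mul, Complex.norm_real, Real.norm_of_nonneg h]; simp

lemma ww_log (θ : ℝ) (h0 : 0 < θ) (h1 : θ < π / 6) : Complex.log (1 - ww θ) = 2 * θ * Complex.I := by
  have : 1 - ww θ = Complex.exp (2 * θ * Complex.I) := by
    rw [Complex.exp_mul_I, Complex.cos_two_mul, Complex.sin_two_mul]
    unfold ww
    push_cast
    linear_combination (-2:ℂ) * (Complex.sin_sq_add_cos_sq θ)
  rw [this, Complex.log_exp]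
  · simp; linarith [pi_pos]
  · simp; linarith [pi_pos]

lemma Lf_deriv (θ : ℝ) (h : 0 < Real.sin θ) : HasDerivAt Lf (Real.cos θ / Real.sin θ) θ := by
  have := ((Real.hasDerivAt_sin θ).const_mul 2).log (by positivity)
  refine this.congr_deriv ?_
  field_simp

lemma el_deriv (θ : ℝ) (h : 0 < Real.sin θ) :
    HasDerivAt el ((Real.cos θ / Real.sin θ : ℝ) + Complex.I) θ := by
  have h1 := (Lf_deriv θ h).ofReal_comp
  have h2 := (((hasDerivAt_id θ).sub_const (π/2)).ofReal_comp).mul_const Complex.I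
  have := h1.add h2
  refine this.congr_deriv ?_
  simp

lemma ww_deriv (θ : ℝ) (h : 0 < Real.sin θ) :
    HasDerivAt ww (ww θ * ((Real.cos θ / Real.sin θ : ℝ) + Complex.I)) θ := by
  have h1 := (Real.hasDerivAt_sin θ).ofReal_comp
  have h2 := (Real.hasDerivAt_cos θ).ofReal_comp
  have := (h1.const_mul (2:ℂ)).mul (h1.sub (h2.mul_const Complex.I))
  refine this.congr_deriv ?_
  unfold ww
  simp only [Pi.sub_apply]
  have hs : (Real.sin θ : ℂ) ≠ 0 := by exact_mod_cast h.ne'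
  rw [Complex.ofReal_div, Complex.ofReal_neg]
  field_simp
  linear_combination ((Real.cos θ : ℂ) * Real.sin θ) * Complex.I_sq

lemma ww_ne (θ : ℝ) (h : 0 < Real.sin θ) : ww θ ≠ 0 := by
  rw [← norm_ne_zero_iff, ww_norm θ h.le]; positivity

noncomputable def AA (θ : ℝ) : ℂ :=
  el θ ^ 2 * (2 * θ * Complex.I) + 2 * (el θ * Li 2 (ww θ)) - 2 * Li 3 (ww θ)

lemma sin_facts (θ : ℝ) (h0 : 0 < θ) (h1 : θ < π / 6) : 0 < Real.sin θ ∧ Real.sin θ < 1/2 := by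
  constructor
  · exact Real.sin_pos_of_pos_of_lt_pi h0 (by linarith [pi_pos])
  · rw [← Real.sin_pi_div_six]
    exact Real.sin_lt_sin_of_lt_of_le_pi_div_two (by linarith) (by linarith [pi_pos]) h1

lemma AA_deriv (θ : ℝ) (h0 : 0 < θ) (h1 : θ < π / 6) :
    HasDerivAt AA (2 * Complex.I * el θ ^ 2) θ := by
  obtain ⟨hs, hs2⟩ := sin_facts θ h0 h1
  have hn : ‖ww θ‖ < 1 := by rw [ww_norm θ hs.le]; linarith
  have hw := ww_deriv θ hs
  have he := el_deriv θ hs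
  have hw0 := ww_ne θ hs
  have hL2 : HasDerivAt (fun θ => Li 2 (ww θ)) _ θ :=
    HasDerivAt.comp θ (PP_hasDerivAt' (fun _ => 1) one_abs es hes 1 (ww θ) hn hw0) hw
  have hL3 : HasDerivAt (fun θ => Li 3 (ww θ)) _ θ :=
    HasDerivAt.comp θ (PP_hasDerivAt' (fun _ => 1) one_abs es hes 2 (ww θ) hn hw0) hw
  have hid : HasDerivAt (fun θ : ℝ => 2 * (θ:ℂ) * Complex.I) (2 * 1 * Complex.I) θ := by
    have := (((hasDerivAt_id θ).ofReal_comp).const_mul (2:ℂ)).mul_const Complex.I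
    simpa using this
  have := (((he.pow 2).mul hid).add ((he.mul hL2).const_mul 2)).sub (hL3.const_mul 2)
  refine this.congr_deriv ?_
  rw [PP_log _ hn, ww_log θ h0 h1]
  simp only [Li, Pi.pow_apply]
  field_simp
  push_cast
  ring

noncomputable def KK (θ : ℝ) : ℝ :=
  PP bb eo 3 (Real.sin θ) - PP bb eo 2 (Real.sin θ) * Lf θ + (1/2) * (θ * Lf θ ^ 2)

lemma KK_deriv (θ : ℝ) (h0 : 0 < θ) (h1 : θ < π / 6) :
    HasDerivAt KK ((1/2) * Lf θ ^ 2) θ := by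
  obtain ⟨hs, hs2⟩ := sin_facts θ h0 h1
  have hn : ‖Real.sin θ‖ < 1 := by rw [Real.norm_of_nonneg hs.le]; linarith
  have hL := Lf_deriv θ hs
  have hL2 : HasDerivAt (fun θ => PP bb eo 2 (Real.sin θ)) _ θ :=
    HasDerivAt.comp θ (PP_hasDerivAt' bb bb_abs eo heo 1 (Real.sin θ) hn hs.ne') (Real.hasDerivAt_sin θ)
  have hL3 : HasDerivAt (fun θ => PP bb eo 3 (Real.sin θ)) _ θ :=
    HasDerivAt.comp θ (PP_hasDerivAt' bb bb_abs eo heo 2 (Real.sin θ) hn hs.ne') (Real.hasDerivAt_sin θ)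
  have := (hL3.sub (hL2.mul hL)).add (((hasDerivAt_id θ).mul (hL.pow 2)).const_mul (1/2))
  refine this.congr_deriv ?_
  rw [PP_arcsin _ (by simpa using hn), Real.arcsin_sin (by linarith [pi_pos]) (by linarith [pi_pos])]
  simp only [id, Pi.pow_apply]
  field_simp
  push_cast
  ring

noncomputable def Ph (θ : ℝ) : ℝ := KK θ - (1/4) * (AA θ).im - (1/6) * (θ - π/2)^3

lemma Ph_deriv (θ : ℝ) (h0 : 0 < θ) (h1 : θ < π / 6) : HasDerivAt Ph 0 θ := by
  have hA : HasDerivAt (fun θ => (AA θ).im) (2 * Complex.I * el θ ^ 2).im θ :=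
    (Complex.imCLM.hasFDerivAt.comp_hasDerivAt θ (AA_deriv θ h0 h1))
  have hc := (((hasDerivAt_id θ).sub_const (π/2)).pow 3).const_mul (1/6 : ℝ)
  have := ((KK_deriv θ h0 h1).sub (hA.const_mul (1/4))).sub hc
  refine this.congr_deriv ?_
  simp [el, pow_two]
  ring

lemma Ph_cont (a : ℝ) (ha : 0 < a) : ContinuousOn Ph (Set.Icc a (π/6)) := by
  have hsin : ∀ θ ∈ Set.Icc a (π/6), 0 < Real.sin θ ∧ Real.sin θ ≤ 1/2 := by
    intro θ hθ
    constructor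
    · exact Real.sin_pos_of_pos_of_lt_pi (by linarith [hθ.1]) (by linarith [pi_pos, hθ.2])
    · rw [← Real.sin_pi_div_six]
      exact Real.sin_le_sin_of_le_of_le_pi_div_two (by linarith [hθ.1, pi_pos]) (by linarith [pi_pos]) hθ.2
  have hL : ContinuousOn Lf (Set.Icc a (π/6)) := fun θ hθ =>
    (Lf_deriv θ (hsin θ hθ).1).continuousAt.continuousWithinAt
  have he : ContinuousOn el (Set.Icc a (π/6)) := fun θ hθ =>
    (el_deriv θ (hsin θ hθ).1).continuousAt.continuousWithinAt
  have hw : ContinuousOn ww (Set.Icc a (π/6)) := fun θ hθ =>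
    (ww_deriv θ (hsin θ hθ).1).continuousAt.continuousWithinAt
  have hmw : Set.MapsTo ww (Set.Icc a (π/6)) (Metric.closedBall 0 1) := by
    intro θ hθ
    have := hsin θ hθ
    simp only [mem_closedBall_zero_iff]
    rw [ww_norm θ this.1.le]; linarith
  have hms : Set.MapsTo Real.sin (Set.Icc a (π/6)) (Metric.closedBall 0 1) := by
    intro θ hθ
    have := hsin θ hθ
    simp only [mem_closedBall_zero_iff]
    rw [Real.norm_of_nonneg this.1.le]; linarith
  have l2 : ContinuousOn (fun θ => Li 2 (ww θ)) (Set.Icc a (π/6)) :=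
    (PP_continuousOn (fun _ => 1) one_abs es hes 0).comp hw hmw
  have l3 : ContinuousOn (fun θ => Li 3 (ww θ)) (Set.Icc a (π/6)) :=
    (PP_continuousOn (fun _ => 1) one_abs es hes 1).comp hw hmw
  have s2 : ContinuousOn (fun θ => PP bb eo 2 (Real.sin θ)) (Set.Icc a (π/6)) :=
    (PP_continuousOn bb bb_abs eo heo 0).comp Real.continuous_sin.continuousOn hms
  have s3 : ContinuousOn (fun θ => PP bb eo 3 (Real.sin θ)) (Set.Icc a (π/6)) :=
    (PP_continuousOn bb bb_abs eo heo 1).comp Real.continuous_sin.continuousOn hms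
  have hA : ContinuousOn AA (Set.Icc a (π/6)) := by
    unfold AA; fun_prop
  have hK : ContinuousOn KK (Set.Icc a (π/6)) := by
    unfold KK; fun_prop
  have hAi : ContinuousOn (fun θ => (AA θ).im) (Set.Icc a (π/6)) :=
    Complex.continuous_im.comp_continuousOn hA
  unfold Ph; fun_prop

lemma Ph_const (a : ℝ) (ha : 0 < a) (ha' : a < π/6) : Ph a = Ph (π/6) :=
  (constant_of_has_deriv_right_zero (Ph_cont a ha)
    (fun x hx => (Ph_deriv x (ha.trans_le hx.1) hx.2).hasDerivWithinAt) (π/6) ⟨ha'.le, le_rfl⟩).symm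

lemma Ph_end : Ph (π/6) = PP bb eo 3 (1/2 : ℝ) + π^3/216 := by
  have hL : Lf (π/6) = 0 := by simp [Lf]
  have hw : ww (π/6) = Complex.exp ((-(π/3) : ℝ) * Complex.I) := by
    rw [Complex.exp_mul_I, ← Complex.ofReal_cos, ← Complex.ofReal_sin, Real.cos_neg, Real.sin_neg,
      Real.cos_pi_div_three, Real.sin_pi_div_three, ww, Real.sin_pi_div_six, Real.cos_pi_div_six]
    push_cast; ring
  have he : el (π/6) = ((-(π/3) : ℝ) : ℂ) * Complex.I := by
    rw [el, hL]; push_cast; ring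
  have hA : (AA (π/6)).im = π^3/162 := by
    rw [AA, hw, he]
    have h2 := Li2_re
    have h3 := Li3_im
    set u := Li 2 (Complex.exp ((-(π/3) : ℝ) * Complex.I))
    set v := Li 3 (Complex.exp ((-(π/3) : ℝ) * Complex.I))
    have e1 : (((-(π/3) : ℝ) : ℂ) * Complex.I)^2 * (2 * ((π/6 : ℝ):ℂ) * Complex.I) = ((-(π^3/27) : ℝ) : ℂ) * Complex.I := by
      rw [mul_pow, Complex.I_sq]; push_cast; ring
    have e2 : 2 * (((-(π/3) : ℝ) : ℂ) * Complex.I * u) = ((-(2*π/3) : ℝ) : ℂ) * (Complex.I * u) := by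
      push_cast; ring
    rw [e1, e2, Complex.sub_im, Complex.add_im, Complex.im_ofReal_mul, Complex.im_ofReal_mul, Complex.I_im, Complex.I_mul_im, h2, show (2:ℂ) = ((2:ℝ):ℂ) by norm_num, Complex.im_ofReal_mul, h3]
    ring
  rw [Ph, hA, KK, hL, Real.sin_pi_div_six]
  ring

lemma Ph_bound (θ : ℝ) (h0 : 0 < θ) (h1 : θ < π / 6) :
    |Ph θ + (1/6) * (θ - π/2)^3| ≤ (6 * CC + 9) * (Real.sin θ * (Lf θ ^ 2 + 1)) := by
  obtain ⟨hs, hs2⟩ := sin_facts θ h0 h1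
  have hC := CC_nonneg
  have hn : ‖Real.sin θ‖ = Real.sin θ := Real.norm_of_nonneg hs.le
  have hw := ww_norm θ hs.le
  have b2 := PP_le bb bb_abs eo heo 0 (Real.sin θ) (by rw [hn]; linarith)
  have b3 := PP_le bb bb_abs eo heo 1 (Real.sin θ) (by rw [hn]; linarith)
  have c2 : ‖Li 2 (ww θ)‖ ≤ _ := PP_le (fun _ => 1) one_abs es hes 0 (ww θ) (by rw [hw]; linarith)
  have c3 : ‖Li 3 (ww θ)‖ ≤ _ := PP_le (fun _ => 1) one_abs es hes 1 (ww θ) (by rw [hw]; linarith)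
  rw [hn] at b2 b3
  rw [hw] at c2 c3
  have hθ : θ ≤ 2 * Real.sin θ := by
    have h := Real.mul_le_sin h0.le (by linarith [pi_pos])
    have hp := pi_le_four
    have hp0 := pi_pos
    rw [div_mul_eq_mul_div, div_le_iff₀ hp0] at h
    nlinarith
  set s := Real.sin θ
  set L := Lf θ with hLdef
  set q := L^2 + 1 with hq
  have hq1 : 1 ≤ q := by nlinarith [sq_nonneg L]
  have hLq : |L| ≤ q := by nlinarith [sq_abs L, sq_nonneg (|L| - 1), abs_nonneg L]
  have hel : ‖el θ‖ ≤ |L| + 2 := by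
    unfold el
    refine (norm_add_le _ _).trans ?_
    rw [norm_mul, Complex.norm_I, Complex.norm_real, Complex.norm_real, mul_one, Real.norm_eq_abs, Real.norm_eq_abs]
    have : |θ - π/2| ≤ 2 := by
      rw [abs_le]; constructor <;> linarith [pi_le_four]
    linarith
  have hel1 : ‖el θ‖ ≤ 3 * q := by linarith
  have hel2 : ‖el θ‖^2 ≤ 8 * q := by
    calc ‖el θ‖^2 ≤ (|L| + 2)^2 := by gcongr
      _ ≤ 8 * q := by nlinarith [sq_abs L, sq_nonneg (|L| - 2)]
  have hA : ‖AA θ‖ ≤ (32 + 16 * CC) * (s * q) := by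
    unfold AA
    refine (norm_sub_le _ _).trans ((add_le_add_left (norm_add_le _ _) _).trans ?_)
    simp only [norm_mul, norm_pow, Complex.norm_I, Complex.norm_real, Complex.norm_ofNat, mul_one]
    rw [Real.norm_of_nonneg h0.le]
    have t1 : ‖el θ‖^2 * (2 * θ) ≤ (8 * q) * (2 * (2 * s)) := by gcongr
    have t2 : ‖el θ‖ * ‖Li 2 (ww θ)‖ ≤ (3 * q) * (CC * (2 * s)) := by gcongr
    have t3 : CC * s ≤ CC * s * q := le_mul_of_one_le_right (by positivity) hq1
    nlinarith
  have hK : |KK θ| ≤ (2 * CC + 1) * (s * q) := by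
    unfold KK
    rw [← Real.norm_eq_abs]
    refine (norm_add_le _ _).trans ((add_le_add_left (norm_sub_le _ _) _).trans ?_)
    rw [norm_mul (PP bb eo 2 s), Real.norm_of_nonneg (show 0 ≤ 1/2 * (θ * L^2) by positivity), Real.norm_eq_abs L]
    have t2 : ‖PP bb eo 2 s‖ * |L| ≤ (CC * s) * q := by gcongr
    have t3 : CC * s ≤ CC * s * q := le_mul_of_one_le_right (by positivity) hq1
    have t4 : θ * L^2 ≤ (2 * s) * q := by gcongr; linarith
    nlinarith
  have hAi : |(AA θ).im| ≤ (32 + 16 * CC) * (s * q) := (Complex.abs_im_le_norm _).trans hA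
  have : Ph θ + (1/6) * (θ - π/2)^3 = KK θ - (1/4) * (AA θ).im := by unfold Ph; ring
  rw [this]
  rw [abs_le] at *
  constructor <;> nlinarith [hK.1, hK.2, hAi.1, hAi.2]

open Filter Topology in
lemma lim_aux : Tendsto (fun θ => Real.sin θ * (Lf θ ^ 2 + 1)) (𝓝[>] 0) (𝓝 0) := by
  have hx : Tendsto (fun θ => 2 * Real.sin θ) (𝓝[>] 0) (𝓝[>] 0) := by
    rw [tendsto_nhdsWithin_iff]
    constructor
    · have : Continuous (fun θ => 2 * Real.sin θ) := by fun_prop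
      have := this.tendsto 0
      simp only [Real.sin_zero, mul_zero] at this
      exact this.mono_left nhdsWithin_le_nhds
    · filter_upwards [Ioo_mem_nhdsGT (show (0:ℝ) < π/6 by positivity)] with θ hθ
      have := (sin_facts θ hθ.1 hθ.2).1
      simp [this]
  have h1 := ((tendsto_log_mul_rpow_nhdsGT_zero (show (0:ℝ) < 1/2 by norm_num)).comp hx).pow 2
  have h2 := h1.add (hx.mono_right nhdsWithin_le_nhds)
  have h3 := h2.const_mul (1/2)
  norm_num at h3
  refine h3.congr' ?_
  filter_upwards [Ioo_mem_nhdsGT (show (0:ℝ) < π/6 by positivity)] with θ hθ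
  have hs := (sin_facts θ hθ.1 hθ.2).1
  simp only [mul_pow, one_div, Lf]
  have : ((2 * Real.sin θ) ^ (1/2:ℝ))^2 = 2 * Real.sin θ := by
    rw [← Real.sqrt_eq_rpow, Real.sq_sqrt (by positivity)]
  simp only [one_div] at this
  rw [this]
  ring

open Filter Topology in
lemma Ph_val : Ph (π/6) = π^3/48 := by
  have h1 : Tendsto (fun θ => Ph θ + (1/6) * (θ - π/2)^3) (𝓝[>] 0) (𝓝 0) := by
    refine squeeze_zero_norm' ?_ (by simpa using lim_aux.const_mul (6 * CC + 9))
    filter_upwards [Ioo_mem_nhdsGT (show (0:ℝ) < π/6 by positivity)] with θ hθ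
    exact Ph_bound θ hθ.1 hθ.2
  have h2 : Tendsto (fun θ : ℝ => Ph (π/6) + (1/6) * (θ - π/2)^3) (𝓝[>] 0) (𝓝 (Ph (π/6) + (1/6) * (0 - π/2)^3)) := by
    have : Continuous (fun θ : ℝ => Ph (π/6) + (1/6) * (θ - π/2)^3) := by fun_prop
    exact (this.tendsto 0).mono_left nhdsWithin_le_nhds
  have h3 := h2.congr' (f₂ := fun θ => Ph θ + (1/6) * (θ - π/2)^3) (by
    filter_upwards [Ioo_mem_nhdsGT (show (0:ℝ) < π/6 by positivity)] with θ hθ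
    rw [Ph_const θ hθ.1 hθ.2])
  have := tendsto_nhds_unique h3 h1
  linarith

theorem stmt_13 : (∑' i : ℕ, ((Nat.choose (2*(i+1)) (i+1)) : ℝ) / ((16:ℝ)^(i+1) * (2*((i:ℝ)+1)+1)^3)) = 7 * Real.pi^3 / 216 - 1 := by
  have h1 := PP_final
  have h2 := Ph_end
  rw [Ph_val, h1] at h2
  linarith
end
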